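/- arXiv:1504.02163 — 4 statements merged into one kernel-verified Lean document; each statement's English description precedes it below -/
import Mathlib

section
/- In the schedule propagation model, for every k ∈ Fin (n+1) the perturbed schedule satisfies a' k = a k + max 0 (Δ − Σ_{j=1}^{k} w j), where the sum ranges over the waiting times at nodes 1,…,k (and is empty for k = 0). -/
/-- Schedule propagation model: `a` is the original schedule determined by the
recurrence `a (k+1) = max (a k + t k) (τ (k+1))`, `w k` is the waiting time at
node `k+1`, and `a'` is the schedule perturbed by an initial delay `Δ ≥ 0`.
Then `a' k = a k + max 0 (Δ - Σ_{j=1}^{k} w j)` for every `k`, the sum ranging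
over the waiting times at nodes `1,…,k` (empty for `k = 0`). -/
theorem stmt_0 (n : ℕ) (τ : Fin (n + 1) → ℝ) (t : Fin n → ℝ)
    (a a' : Fin (n + 1) → ℝ) (w : Fin n → ℝ) (Δ : ℝ) (hΔ : 0 ≤ Δ)
    (ha : ∀ k : Fin n, a k.succ = max (a k.castSucc + t k) (τ k.succ))
    (hw : ∀ k : Fin n, w k = max 0 (τ k.succ - (a k.castSucc + t k)))
    (ha'0 : a' 0 = a 0 + Δ)
    (ha' : ∀ k : Fin n, a' k.succ = max (a' k.castSucc + t k) (τ k.succ)) :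
    ∀ k : Fin (n + 1),
      a' k = a k +
        max 0 (Δ - ∑ j ∈ Finset.univ.filter (fun j : Fin n => (j : ℕ) < (k : ℕ)), w j) := by
  intro k
  induction k using Fin.induction with
  | zero => simp [ha'0, hΔ]
  | succ i ih =>
    have hfilter : Finset.univ.filter (fun j : Fin n => (j : ℕ) < (i.succ : ℕ)) =
        insert i (Finset.univ.filter (fun j : Fin n => (j : ℕ) < (i.castSucc : ℕ))) := by
      ext j
      simp only [Finset.mem_filter, Finset.mem_univ, true_and, Finset.mem_insert, Fin.ext_iff,
        Fin.val_succ, Fin.val_castSucc]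
      omega
    rw [hfilter, Finset.sum_insert (by simp), ha', ih, ha, hw]
    generalize ∑ j ∈ Finset.univ.filter (fun j : Fin n => (j : ℕ) < (i.castSucc : ℕ)), w j = S
    grind
end

section
/- In the schedule propagation model, suppose deadlines τmax : Fin (n+1) → ℝ satisfy a k ≤ τmax k for every k. If Δ ≤ τmax k − a k + Σ_{j=1}^{k} w j for every k ∈ Fin (n+1) (the sum ranging over the waiting times at nodes 1,…,k, empty for k = 0), then the perturbed schedule satisfies a' k ≤ τmax k for every k. In other words, a delay Δ not exceeding, for every node, the node's maximum postponement plus the total waiting time accumulated up to that node, preserves feasibility of all deadlines. -/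
/-- The delay of a schedule at node `k` is the initial delay, reduced by the waiting time
accumulated up to node `k`, and truncated at zero. -/
theorem perturbed_schedule_eq (n : ℕ) (τ : Fin (n + 1) → ℝ) (t : Fin n → ℝ)
    (a a' : Fin (n + 1) → ℝ) (w : Fin n → ℝ) (Δ : ℝ) (hΔ : 0 ≤ Δ)
    (ha : ∀ k : Fin n, a k.succ = max (a k.castSucc + t k) (τ k.succ))
    (hw : ∀ k : Fin n, w k = max 0 (τ k.succ - (a k.castSucc + t k)))
    (ha'0 : a' 0 = a 0 + Δ)
    (ha' : ∀ k : Fin n, a' k.succ = max (a' k.castSucc + t k) (τ k.succ))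
    (k : Fin (n + 1)) :
    a' k = a k + max 0 (Δ -
      ∑ j ∈ Finset.univ.filter (fun j : Fin n => (j : ℕ) < (k : ℕ)), w j) := by
  induction k using Fin.induction with
  | zero => simp [ha'0, hΔ]
  | succ k ih =>
    have hfilter : (Finset.univ.filter fun j : Fin n => (j : ℕ) < (k.succ : ℕ)) =
        insert k (Finset.univ.filter fun j : Fin n => (j : ℕ) < (k.castSucc : ℕ)) := by
      ext j
      simp [Fin.ext_iff]
      omega
    rw [hfilter, Finset.sum_insert (by simp), ha', ih, ha, hw]
    grind

/-- Schedule propagation model with deadlines `τmax`: if the original schedule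
meets all deadlines and the initial delay `Δ` does not exceed, for every node
`k`, the node's maximum postponement `τmax k - a k` plus the total waiting time
accumulated up to node `k`, then the perturbed schedule also meets all
deadlines. This is the abstract content of condition (28) of Proposition 2. -/
theorem stmt_2 (n : ℕ) (τ : Fin (n + 1) → ℝ) (t : Fin n → ℝ)
    (a a' : Fin (n + 1) → ℝ) (w : Fin n → ℝ) (τmax : Fin (n + 1) → ℝ)
    (Δ : ℝ) (hΔ : 0 ≤ Δ)
    (ha : ∀ k : Fin n, a k.succ = max (a k.castSucc + t k) (τ k.succ))
    (hw : ∀ k : Fin n, w k = max 0 (τ k.succ - (a k.castSucc + t k)))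
    (ha'0 : a' 0 = a 0 + Δ)
    (ha' : ∀ k : Fin n, a' k.succ = max (a' k.castSucc + t k) (τ k.succ))
    (hfeas : ∀ k : Fin (n + 1), a k ≤ τmax k)
    (hbound : ∀ k : Fin (n + 1),
      Δ ≤ τmax k - a k +
        ∑ j ∈ Finset.univ.filter (fun j : Fin n => (j : ℕ) < (k : ℕ)), w j) :
    ∀ k : Fin (n + 1), a' k ≤ τmax k := by
  intro k
  rw [perturbed_schedule_eq n τ t a a' w Δ hΔ ha hw ha'0 ha' k, ← le_sub_iff_add_le']
  exact max_le (sub_nonneg.2 (hfeas k)) (sub_le_iff_le_add.2 (hbound k))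
end

section
/- Proposition 1: Let ω = (0, p_1, d_1, …, p_n, d_n, 0) be a feasible route in the E-VReP route model, with arrival times a and waiting times w as in the model, and let (p, d) be a pair with pickup window left endpoint τpmin, delivery window left endpoint τdmin, drive time t_pd ≥ 0 from p to d, bike time t_{d_{i−1}p} ≥ 0 from delivery i−1 to p, and bike time t_{dp_i} ≥ 0 from d to pickup i. Insert (p, d) between delivery i−1 and pickup i: the arrival time at p is a_p = ad_{i−1} + wd_{i−1} + q' + t_{d_{i−1}p}, and the new arrival time at pickup i is A = max (max a_p τpmin + q'' + t_pd) τdmin + q' + t_{dp_i}. Assume A ≥ ap_i. If the arrival and waiting times of all nodes preceding p are left unchanged and those of pickup i, delivery i, …, pickup n, delivery n and of the final return to the depot are recomputed by the same model recurrences starting from the arrival value A at pickup i, then the return time to the depot increases by exactly TE(ω) = max 0 (A − ap_i − Σ_{k=p_i}^{d_n} w_k), where the sum is over the waiting times of all nodes from pickup i to delivery n in the original route. -/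
/-- A delay `D` before a wait of length `max 0 (t - x)` leaves the delay
`max 0 (D - max 0 (t - x))` after it. -/
theorem delay_after_wait (x t D : ℝ) (hD : 0 ≤ D) :
    x + D + max 0 (t - (x + D)) = x + max 0 (t - x) + max 0 (D - max 0 (t - x)) := by
  grind

/-- A delay `D` on arrival at a pickup becomes, after the waits at the pickup and at the
corresponding delivery, the delay `max 0 (D - (wp + wd))`. -/
theorem delay_after_pair {ap wp ad wd ap' wp' ad' wd' D q' q'' e tp td : ℝ} (hD : 0 ≤ D)
    (hap : ap' = ap + D)
    (hwp : wp = max 0 (tp - ap)) (had : ad = ap + wp + q'' + e)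
    (hwd : wd = max 0 (td - ad - q'))
    (hwp' : wp' = max 0 (tp - ap')) (had' : ad' = ap' + wp' + q'' + e)
    (hwd' : wd' = max 0 (td - ad' - q')) :
    ad' + wd' = ad + wd + max 0 (D - (wp + wd)) := by
  have h₁ := delay_after_wait ap tp D hD
  rw [← hap, ← hwp', ← hwp] at h₁
  have had_delay : ad' = ad + max 0 (D - wp) := by linarith
  have h₂ := delay_after_wait ad (td - q') (max 0 (D - wp)) (le_max_left _ _)
  rw [← had_delay, sub_right_comm td q' ad', sub_right_comm td q' ad, ← hwd', ← hwd] at h₂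
  have hwd_nonneg : 0 ≤ wd := hwd ▸ le_max_left _ _
  rw [h₂]
  grind

theorem Fin.Icc_succ_right_eq_insert {n : ℕ} {i : Fin (n + 1)} {k : Fin n}
    (h : i ≤ k.succ) :
    Finset.Icc i k.succ = insert k.succ (Finset.Icc i k.castSucc) := by
  ext x
  simp only [Finset.mem_Icc, Finset.mem_insert, Fin.le_def, Fin.ext_iff, Fin.val_succ,
    Fin.val_castSucc] at h ⊢
  omega


/-- Proposition 1 of the paper. A feasible E-VReP route serves pairs indexed by
`Fin (n+1)`; its arrival times `ap, ad` and waiting times `wp, wd` satisfy the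
model recurrences, and the original route is feasible. A pair `(p, d)` is
inserted between delivery `j.castSucc` and pickup `j.succ`: the arrival time at
`p` is `apP = ad j.castSucc + wd j.castSucc + q' + td1p`, and the new arrival
time at pickup `j.succ` is `A = max (max apP τpminP + q'' + tpd) τdminP + q' + tdpi`.
Assuming `A ≥ ap j.succ`, if the arrival and waiting times of all nodes
preceding `p` are left unchanged and those from pickup `j.succ` onwards are
recomputed by the same recurrences starting from the arrival value `A`, then
the return time to the depot increases by exactly
`TE = max 0 (A - ap j.succ - Σ_{k ≥ j.succ} (wp k + wd k))`. -/
theorem stmt_3 (n : ℕ) (q' q'' Γ L T start tret : ℝ)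
    (hq' : 0 ≤ q') (hq'' : 0 ≤ q'') (hΓ : 0 < Γ) (hL : 0 < L) (htret : 0 ≤ tret)
    (τpmin τpmax ρp τdmin τdmax ρd b e ℓ : Fin (n + 1) → ℝ)
    (hτp : ∀ k, τpmin k ≤ τpmax k) (hτd : ∀ k, τdmin k ≤ τdmax k)
    (hb : ∀ k, 0 ≤ b k) (he : ∀ k, 0 ≤ e k) (hℓ : ∀ k, 0 ≤ ℓ k)
    -- the original schedule
    (ap wp ad wd : Fin (n + 1) → ℝ)
    (hap0 : ap 0 = start + b 0)
    (hap : ∀ k : Fin n, ap k.succ = ad k.castSucc + wd k.castSucc + q' + b k.succ)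
    (hwp : ∀ k, wp k = max 0 (τpmin k - ap k))
    (had : ∀ k, ad k = ap k + wp k + q'' + e k)
    (hwd : ∀ k, wd k = max 0 (τdmin k - ad k - q'))
    -- feasibility of the original route
    (hfeas1 : ∀ k, ap k ≤ τpmax k)
    (hfeas2 : ∀ k, ad k ≤ τdmax k)
    (hfeas3 : ∀ k, min (ρp k + (ap k + wp k - τpmin k) / Γ) 1 - ℓ k / L ≥ 0)
    (hfeas4 : ∀ k, min (ρp k + (ap k + wp k - τpmin k) / Γ) 1 - ℓ k / L
        + (τdmax k - ad k) / Γ ≥ ρd k)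
    (hfeas5 : ad (Fin.last n) + wd (Fin.last n) + q' + tret - start ≤ T)
    -- the pair (p, d) inserted between delivery j.castSucc and pickup j.succ
    (j : Fin n) (τpminP τdminP tpd td1p tdpi : ℝ)
    (htpd : 0 ≤ tpd) (htd1p : 0 ≤ td1p) (htdpi : 0 ≤ tdpi)
    (apP A : ℝ)
    (hapP : apP = ad j.castSucc + wd j.castSucc + q' + td1p)
    (hA : A = max (max apP τpminP + q'' + tpd) τdminP + q' + tdpi)
    (hge : ap j.succ ≤ A)
    -- the new schedule: unchanged before p, recomputed from A at pickup j.succ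
    (ap' wp' ad' wd' : Fin (n + 1) → ℝ)
    (hpre : ∀ k : Fin (n + 1), (k : ℕ) < (j.succ : ℕ) →
        ap' k = ap k ∧ wp' k = wp k ∧ ad' k = ad k ∧ wd' k = wd k)
    (hstart : ap' j.succ = A)
    (hap' : ∀ k : Fin n, (j : ℕ) < (k : ℕ) →
        ap' k.succ = ad' k.castSucc + wd' k.castSucc + q' + b k.succ)
    (hwp' : ∀ k : Fin (n + 1), (j.succ : ℕ) ≤ (k : ℕ) →
        wp' k = max 0 (τpmin k - ap' k))
    (had' : ∀ k : Fin (n + 1), (j.succ : ℕ) ≤ (k : ℕ) →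
        ad' k = ap' k + wp' k + q'' + e k)
    (hwd' : ∀ k : Fin (n + 1), (j.succ : ℕ) ≤ (k : ℕ) →
        wd' k = max 0 (τdmin k - ad' k - q')) :
    ad' (Fin.last n) + wd' (Fin.last n) + q' + tret
      = (ad (Fin.last n) + wd (Fin.last n) + q' + tret)
        + max 0 (A - ap j.succ
            - ∑ k ∈ Finset.univ.filter
                (fun k : Fin (n + 1) => (j.succ : ℕ) ≤ (k : ℕ)), (wp k + wd k)) := by
  have key : ∀ k : Fin (n + 1), j.succ ≤ k →
      ad' k + wd' k = ad k + wd k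
        + max 0 (A - ap j.succ - ∑ i ∈ Finset.Icc j.succ k, (wp i + wd i)) := by
    intro k
    induction k using Fin.induction with
    | zero => exact fun h => absurd h (not_le.mpr j.succ_pos)
    | succ k ih =>
      intro h
      rcases h.eq_or_lt with h_eq | h_lt
      · rw [← h_eq, Finset.Icc_self, Finset.sum_singleton]
        exact delay_after_pair (sub_nonneg.mpr hge) (by linarith) (hwp _) (had _) (hwd _)
          (hwp' _ le_rfl) (had' _ le_rfl) (hwd' _ le_rfl)
      · have hjk : j < k := Fin.succ_lt_succ_iff.mp h_lt
        have hnot : k.succ ∉ Finset.Icc j.succ k.castSucc := fun hmem =>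
          (Finset.mem_Icc.mp hmem).2.not_gt Fin.castSucc_lt_succ
        have hdelay := ih (Fin.succ_le_castSucc_iff.mpr hjk)
        have hpair := delay_after_pair (le_max_left _ _)
          (by linarith [hap k, hap' k hjk] : ap' k.succ = ap k.succ
            + max 0 (A - ap j.succ - ∑ i ∈ Finset.Icc j.succ k.castSucc, (wp i + wd i)))
          (hwp _) (had _) (hwd _) (hwp' _ h) (had' _ h) (hwd' _ h)
        have hwp_nonneg : 0 ≤ wp k.succ := hwp k.succ ▸ le_max_left _ _
        have hwd_nonneg : 0 ≤ wd k.succ := hwd k.succ ▸ le_max_left _ _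
        rw [hpair, Fin.Icc_succ_right_eq_insert h, Finset.sum_insert hnot]
        grind
  have hfilter : Finset.univ.filter (fun k : Fin (n + 1) => (j.succ : ℕ) ≤ (k : ℕ))
      = Finset.Icc j.succ (Fin.last n) := by
    ext k
    simp only [Finset.mem_filter, Finset.mem_univ, true_and, Finset.mem_Icc, Fin.le_last, and_true]
    exact Fin.le_def.symm
  rw [hfilter]
  linarith [key (Fin.last n) (Fin.le_last _)]
end

section
/- Let t0p, tpd, td0, q', q'' be nonnegative real numbers and τpmin, τpmax, τdmin, T real numbers. Suppose a worker departs the depot at time s0, arrives at the pickup location at time ap with ap ≥ s0 + t0p, starts the pickup at time up with up ≥ ap and up ≤ τpmax, performs the delivery at a time ud with ud ≥ max (up + q'' + tpd) τdmin, and returns to the depot at time ud + q' + td0. If the route duration satisfies (ud + q' + td0) − s0 ≤ T, then condition (17) holds: t0p + td0 + max (tpd + q'') (τdmin − τpmax) + q' ≤ T. -/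
/-- Necessity of condition (17): if a worker departs the depot at time `s0`,
arrives at the pickup location at time `ap ≥ s0 + t0p`, starts the pickup at
time `up` with `ap ≤ up ≤ τpmax`, performs the delivery at a time
`ud ≥ max (up + q'' + tpd) τdmin`, returns to the depot at `ud + q' + td0`,
and the route duration is at most `T`, then
`t0p + td0 + max (tpd + q'') (τdmin - τpmax) + q' ≤ T`. -/
theorem stmt_7 (t0p tpd td0 q' q'' : ℝ)
    (ht0p : 0 ≤ t0p) (htpd : 0 ≤ tpd) (htd0 : 0 ≤ td0)
    (hq' : 0 ≤ q') (hq'' : 0 ≤ q'')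
    (τpmin τpmax τdmin T s0 ap up ud : ℝ)
    (hap : s0 + t0p ≤ ap)
    (hup1 : ap ≤ up) (hup2 : up ≤ τpmax)
    (hud : max (up + q'' + tpd) τdmin ≤ ud)
    (hT : (ud + q' + td0) - s0 ≤ T) :
    t0p + td0 + max (tpd + q'') (τdmin - τpmax) + q' ≤ T := by
  obtain ⟨h_drive, h_window⟩ := max_le_iff.mp hud
  have h_max : max (tpd + q'') (τdmin - τpmax) ≤ T - t0p - td0 - q' :=
    max_le (by linarith) (by linarith)
  linarith
end
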